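/- arXiv:2505.19295 — 2 statements merged into one kernel-verified Lean document; each statement's English description precedes it below -/
import Mathlib

section
/- Let $\Bbbk$ be a field and, for $i = 1,\dots,r$, let $m_i$ and $n_i$ be non-negative integers with $(m_i, n_i) \neq (0,0)$. Then the polynomials $X^{m_i} Y^{n_i} - 1$, $i = 1,\dots,r$, in the polynomial ring $\Bbbk[X,Y]$ have a non-constant common factor if and only if $m_i n_j - m_j n_i = 0$ for every pair $1 \le i, j \le r$. -/
open MvPolynomial

/-- Eliminating `y` from the congruences `x ^ m * y ^ n = 1` and `x ^ m' * y ^ n' = 1`. -/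
theorem dvd_pow_sub_one_of_dvd_mul_pow_sub_one {R : Type*} [CommRing R] {f x y : R}
    {m n m' n' : ℕ} (h₁ : f ∣ x ^ m * y ^ n - 1) (h₂ : f ∣ x ^ m' * y ^ n' - 1)
    (hlt : m' * n < m * n') : f ∣ x ^ (m * n' - m' * n) - 1 := by
  have key₁ : f ∣ x ^ (m * n') * y ^ (n * n') - 1 := by
    have := h₁.trans (sub_dvd_pow_sub_pow (x ^ m * y ^ n) 1 n')
    rwa [one_pow, mul_pow, ← pow_mul, ← pow_mul] at this
  have key₂ : f ∣ x ^ (m' * n) * y ^ (n * n') - 1 := by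
    have := h₂.trans (sub_dvd_pow_sub_pow (x ^ m' * y ^ n') 1 n)
    rwa [one_pow, mul_pow, ← pow_mul, ← pow_mul, mul_comm n' n] at this
  obtain ⟨d, hd⟩ := Nat.exists_eq_add_of_le hlt.le
  rw [hd, pow_add] at key₁
  rw [hd, Nat.add_sub_cancel_left]
  have : x ^ d - 1 = (x ^ (m' * n) * x ^ d * y ^ (n * n') - 1)
      - (x ^ (m' * n) * y ^ (n * n') - 1) * x ^ d := by ring
  rw [this]
  exact dvd_sub key₁ (key₂.mul_right _)

theorem MvPolynomial.X_pow_sub_one_ne_zero {σ R : Type*} [CommRing R] [Nontrivial R]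
    (i : σ) {d : ℕ} (hd : d ≠ 0) : (X i ^ d - 1 : MvPolynomial σ R) ≠ 0 := by
  intro h
  have := congrArg (eval (fun _ => (0 : R))) h
  simp [hd] at this

theorem MvPolynomial.degreeOf_eq_zero_of_dvd_X_pow_sub_one {σ R : Type*} [CommRing R]
    [IsDomain R] {f : MvPolynomial σ R} {i j : σ} (hij : i ≠ j) {d : ℕ} (hd : d ≠ 0)
    (hf : f ∣ X i ^ d - 1) : degreeOf j f = 0 := by
  obtain ⟨g, hg⟩ := hf
  have hne := X_pow_sub_one_ne_zero (R := R) i hd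
  have hdeg : degreeOf j (X i ^ d - 1 : MvPolynomial σ R) = 0 := by
    refine Nat.le_zero.mp ((degreeOf_sub_le _ _ _).trans ?_)
    have h₁ : degreeOf j (X i ^ d : MvPolynomial σ R) = 0 := degreeOf_X_pow_of_ne d hij.symm
    have h₂ : degreeOf j (1 : MvPolynomial σ R) = 0 := degreeOf_one j
    omega
  rw [hg] at hne hdeg
  rw [degreeOf_mul_eq (left_ne_zero_of_mul hne) (right_ne_zero_of_mul hne)] at hdeg
  omega

theorem MvPolynomial.totalDegree_eq_zero_of_dvd {R : Type*} [CommRing R] [IsDomain R]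
    {f : MvPolynomial (Fin 2) R} {m n m' n' : ℕ}
    (h₁ : f ∣ X 0 ^ m * X 1 ^ n - 1) (h₂ : f ∣ X 0 ^ m' * X 1 ^ n' - 1)
    (hlt : m' * n < m * n') : f.totalDegree = 0 := by
  have hX := dvd_pow_sub_one_of_dvd_mul_pow_sub_one h₁ h₂ hlt
  rw [mul_comm (X 0 ^ m)] at h₁
  rw [mul_comm (X 0 ^ m')] at h₂
  have hY := dvd_pow_sub_one_of_dvd_mul_pow_sub_one h₂ h₁
    (by rwa [mul_comm n m', mul_comm n' m])
  have d₁ := degreeOf_eq_zero_of_dvd_X_pow_sub_one (j := 1) (by decide)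
    (Nat.sub_pos_of_lt hlt).ne' hX
  have d₀ := degreeOf_eq_zero_of_dvd_X_pow_sub_one (j := 0) (by decide)
    (Nat.sub_pos_of_lt (by rwa [mul_comm n m', mul_comm n' m])).ne' hY
  rw [totalDegree_eq_zero_iff]
  intro s hs i
  have hle := monomial_le_degreeOf i hs
  fin_cases i
  · exact Nat.le_zero.mp (hle.trans_eq d₀)
  · exact Nat.le_zero.mp (hle.trans_eq d₁)

theorem MvPolynomial.totalDegree_X_pow_mul_X_pow_sub_one_pos {R : Type*} [CommRing R]
    [Nontrivial R] {a b : ℕ} (hab : a ≠ 0 ∨ b ≠ 0) :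
    0 < (X 0 ^ a * X 1 ^ b - 1 : MvPolynomial (Fin 2) R).totalDegree := by
  by_contra hdeg
  have hC := totalDegree_eq_zero_iff_eq_C.mp (Nat.eq_zero_of_not_pos hdeg)
  have h₀ := congrArg (eval (fun _ => (0 : R))) hC
  have h₁ := congrArg (eval (fun _ => (1 : R))) hC
  have hz : (0 : R) ^ a * 0 ^ b = 0 := by
    rcases hab with ha | hb
    · simp [ha]
    · simp [hb]
  simp only [map_sub, map_mul, map_pow, eval_X, eval_C, map_one, hz, one_pow, mul_one,
    sub_self, zero_sub] at h₀ h₁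
  rw [← h₁, neg_eq_zero] at h₀
  exact one_ne_zero h₀

/-- For a field `𝕜` and non-negative integers `mᵢ, nᵢ`
(not both zero), the polynomials `X^{mᵢ} Y^{nᵢ} - 1` in `𝕜[X,Y]` have a
non-constant common factor iff `mᵢ nⱼ - mⱼ nᵢ = 0` for all pairs `i, j`. -/
theorem stmt1 {𝕜 : Type*} [Field 𝕜] (r : ℕ) (m n : Fin r → ℕ)
    (h : ∀ i, (m i, n i) ≠ (0, 0)) :
    (∃ f : MvPolynomial (Fin 2) 𝕜, 0 < f.totalDegree ∧
        ∀ i, f ∣ (X 0) ^ (m i) * (X 1) ^ (n i) - 1) ↔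
      ∀ i j, m i * n j = m j * n i := by
  constructor
  · rintro ⟨f, hf, hdvd⟩ i j
    by_contra hne
    rcases lt_or_gt_of_ne hne with hlt | hlt
    · exact hf.ne' (totalDegree_eq_zero_of_dvd (hdvd j) (hdvd i) hlt)
    · exact hf.ne' (totalDegree_eq_zero_of_dvd (hdvd i) (hdvd j) hlt)
  · intro hdet
    rcases isEmpty_or_nonempty (Fin r) with _ | ⟨⟨i₀⟩⟩
    · exact ⟨X 0, by simp, fun i => isEmptyElim i⟩
    have hpos : 0 < Nat.gcd (m i₀) (n i₀) := by
      refine Nat.pos_of_ne_zero fun h0 => h i₀ ?_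
      rw [Nat.gcd_eq_zero_iff] at h0
      rw [h0.1, h0.2]
    obtain ⟨a, b, hco, ha, hb⟩ := Nat.exists_coprime (m i₀) (n i₀)
    generalize Nat.gcd (m i₀) (n i₀) = g at hpos ha hb
    refine ⟨X 0 ^ a * X 1 ^ b - 1, totalDegree_X_pow_mul_X_pow_sub_one_pos ?_, fun i => ?_⟩
    · by_contra! h0
      simp [h0.1, h0.2] at hco
    · have hi : m i * b = a * n i := by
        have := hdet i i₀
        rw [ha, hb] at this
        apply Nat.eq_of_mul_eq_mul_right hpos
        linarith
      obtain ⟨k, hk⟩ : a ∣ m i := hco.dvd_of_dvd_mul_right ⟨n i, hi⟩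
      obtain ⟨l, hl⟩ : b ∣ n i := hco.symm.dvd_of_dvd_mul_left ⟨m i, by rw [← hi, mul_comm]⟩
      obtain ⟨k, hk, hl⟩ : ∃ k, m i = a * k ∧ n i = b * k := by
        rcases Nat.eq_zero_or_pos a with ha0 | ha0
        · exact ⟨l, by simp [hk, ha0], hl⟩
        · refine ⟨k, hk, Nat.eq_of_mul_eq_mul_left ha0 ?_⟩
          rw [← hi, hk]
          ring
      rw [hk, hl, pow_mul, pow_mul, ← mul_pow]
      simpa using sub_dvd_pow_sub_pow (X 0 ^ a * X 1 ^ b : MvPolynomial (Fin 2) 𝕜) 1 k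
end

section
/- Let $\Bbbk$ be an algebraically closed field, let $a$ and $b$ be positive integers with $\gcd(a,b) = 1$, and let $c \in \Bbbk^\times$. Then the polynomial $X^a Y^b - c$ is irreducible in the polynomial ring $\Bbbk[X,Y]$. -/
open MvPolynomial

/-- A nonzero polynomial whose monomials `X ^ i * Y ^ j` have pairwise distinct weights `i * b - j * a`
does not vanish on the curve `X = t ^ b`, `Y = γ * t ^ (-a)`. -/
lemma aeval_single_ne_zero_of_injOn {𝕜 : Type*} [Field 𝕜] {a b : ℤ} {γ : 𝕜} (hγ : γ ≠ 0)
    {f : MvPolynomial (Fin 2) 𝕜} (hf : f ≠ 0)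
    (hinj : Set.InjOn (fun s : Fin 2 →₀ ℕ => (s 0 : ℤ) * b - s 1 * a) f.support) :
    aeval ![(AddMonoidAlgebra.single b 1 : LaurentPolynomial 𝕜),
      AddMonoidAlgebra.single (-a) γ] f ≠ 0 := by
  obtain ⟨s, hs⟩ := support_nonempty.mpr hf
  intro h
  have hsum : aeval ![(AddMonoidAlgebra.single b 1 : LaurentPolynomial 𝕜),
      AddMonoidAlgebra.single (-a) γ] f = ∑ d ∈ f.support,
        AddMonoidAlgebra.single ((d 0 : ℤ) * b - d 1 * a) (f.coeff d * γ ^ d 1) := by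
    rw [aeval_def, eval₂_eq']
    refine Finset.sum_congr rfl fun d _ => ?_
    simp [- LaurentPolynomial.single_eq_C_mul_T, Fin.prod_univ_two, AddMonoidAlgebra.single_pow, AddMonoidAlgebra.single_mul_single,
      sub_eq_add_neg, LaurentPolynomial.algebraMap_apply, ← LaurentPolynomial.single_eq_C]
  have hcoeff := congrArg (fun p : LaurentPolynomial 𝕜 => p.coeff ((s 0 : ℤ) * b - s 1 * a))
    (hsum.symm.trans h)
  simp only [AddMonoidAlgebra.coeff_sum, Finsupp.finsetSum_apply, AddMonoidAlgebra.coeff_single,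
    AddMonoidAlgebra.coeff_zero, Finsupp.zero_apply] at hcoeff
  rw [Finset.sum_eq_single_of_mem s hs fun d hd hds =>
    Finsupp.single_eq_of_ne' fun hw => hds (hinj hd hs hw), Finsupp.single_eq_same] at hcoeff
  exact mul_ne_zero (mem_support_iff.mp hs) (pow_ne_zero _ hγ) hcoeff

/-- If `a` and `b` are coprime, the weight `i * b - j * a` is injective on pairs with `j < b`. -/
lemma eq_of_weight_eq_of_lt {a b i j i' j' : ℕ} (hb : 0 < b) (hab : a.Coprime b)
    (hj : j < b) (hj' : j' < b) (h : (i : ℤ) * b - j * a = i' * b - j' * a) :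
    i = i' ∧ j = j' := by
  have hdvd : (b : ℤ) ∣ (j' - j) * a := ⟨i' - i, by linarith⟩
  have hdvd' : (b : ℤ) ∣ j' - j :=
    IsCoprime.dvd_of_dvd_mul_right (Nat.isCoprime_iff_coprime.mpr hab.symm) hdvd
  have hzero : (j' : ℤ) - j = 0 :=
    Int.eq_zero_of_abs_lt_dvd hdvd' (by rw [abs_lt]; constructor <;> omega)
  obtain rfl : j = j' := by omega
  have hb' : (b : ℤ) ≠ 0 := by exact_mod_cast hb.ne'
  exact ⟨by exact_mod_cast mul_right_cancel₀ hb' (sub_left_inj.mp h), rfl⟩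

lemma le_degreeOf_of_aeval_single_eq_zero {𝕜 : Type*} [Field 𝕜] {a b : ℕ} (ha : 0 < a)
    (hb : 0 < b) (hab : a.Coprime b) {γ : 𝕜} (hγ : γ ≠ 0) {f : MvPolynomial (Fin 2) 𝕜}
    (hf : f ≠ 0) (h : aeval ![(AddMonoidAlgebra.single (b : ℤ) 1 : LaurentPolynomial 𝕜),
      AddMonoidAlgebra.single (-(a : ℤ)) γ] f = 0) :
    a ≤ degreeOf 0 f ∧ b ≤ degreeOf 1 f := by
  constructor <;> by_contra! hlt <;>
    refine aeval_single_ne_zero_of_injOn hγ hf (fun s hs t ht hst => ?_) h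
  · have hs' := ((degreeOf_lt_iff ha).mp hlt) s hs
    have ht' := ((degreeOf_lt_iff ha).mp hlt) t ht
    have := eq_of_weight_eq_of_lt ha hab.symm hs' ht' (i := s 1) (i' := t 1) (by
      dsimp only at hst; linarith)
    ext k
    fin_cases k
    exacts [this.2, this.1]
  · have hs' := ((degreeOf_lt_iff hb).mp hlt) s hs
    have ht' := ((degreeOf_lt_iff hb).mp hlt) t ht
    have := eq_of_weight_eq_of_lt hb hab hs' ht' hst
    ext k
    fin_cases k
    exacts [this.1, this.2]

lemma isUnit_of_degreeOf_eq_zero {σ 𝕜 : Type*} [Field 𝕜] {f : MvPolynomial σ 𝕜} (hf : f ≠ 0)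
    (h : ∀ i, degreeOf i f = 0) : IsUnit f := by
  have hC : f = C (f.coeff 0) := by
    rw [← totalDegree_eq_zero_iff_eq_C, totalDegree_eq_zero_iff]
    exact fun m hm i => Nat.le_zero.mp (degreeOf_le_iff.mp (h i).le m hm)
  rw [hC] at hf ⊢
  exact (isUnit_iff_ne_zero.mpr fun h0 => hf (by rw [h0, C_0])).map C

/-- Over an algebraically closed field `𝕜`, for positive
integers `a, b` with `gcd(a,b) = 1` and `c ∈ 𝕜ˣ`, the polynomial
`XᵃYᵇ - c` is irreducible in `𝕜[X,Y]`. -/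
theorem stmt18 {𝕜 : Type*} [Field 𝕜] [IsAlgClosed 𝕜] (a b : ℕ)
    (ha : 0 < a) (hb : 0 < b) (hab : Nat.gcd a b = 1) (c : 𝕜) (hc : c ≠ 0) :
    Irreducible ((X 0 : MvPolynomial (Fin 2) 𝕜) ^ a * (X 1) ^ b - C c) := by
  obtain ⟨γ, hγc⟩ := IsAlgClosed.exists_pow_nat_eq c hb
  have hγ : γ ≠ 0 := by
    rintro rfl
    exact hc (by rw [← hγc, zero_pow hb.ne'])
  set P : MvPolynomial (Fin 2) 𝕜 := X 0 ^ a * X 1 ^ b - C c with hP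
  have hP0 : P ≠ 0 := by
    intro h
    have := congrArg (eval 0) h
    simp [hP, ha.ne', hc] at this
  have hvanish : aeval ![(AddMonoidAlgebra.single (b : ℤ) 1 : LaurentPolynomial 𝕜),
      AddMonoidAlgebra.single (-(a : ℤ)) γ] P = 0 := by
    simp [- LaurentPolynomial.single_eq_C_mul_T, hP, AddMonoidAlgebra.single_pow, AddMonoidAlgebra.single_mul_single, hγc,
      LaurentPolynomial.algebraMap_apply, ← LaurentPolynomial.single_eq_C, mul_comm]
  have hdeg0 : degreeOf 0 P ≤ a := by
    refine (degreeOf_sub_le _ _ _).trans (max_le ((degreeOf_mul_le _ _ _).trans ?_) (by simp))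
    simp [degreeOf_X_pow_of_ne]
  have hdeg1 : degreeOf 1 P ≤ b := by
    refine (degreeOf_sub_le _ _ _).trans (max_le ((degreeOf_mul_le _ _ _).trans ?_) (by simp))
    simp [degreeOf_X_pow_of_ne]
  have hcofactor : ∀ f g, P = f * g → aeval
      ![(AddMonoidAlgebra.single (b : ℤ) 1 : LaurentPolynomial 𝕜),
        AddMonoidAlgebra.single (-(a : ℤ)) γ] f = 0 → IsUnit g := by
    intro f g hfg hf
    have hf0 : f ≠ 0 := left_ne_zero_of_mul (hfg ▸ hP0)
    have hg0 : g ≠ 0 := right_ne_zero_of_mul (hfg ▸ hP0)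
    obtain ⟨h0, h1⟩ := le_degreeOf_of_aeval_single_eq_zero ha hb hab hγ hf0 hf
    rw [hfg, degreeOf_mul_eq hf0 hg0] at hdeg0 hdeg1
    refine isUnit_of_degreeOf_eq_zero hg0 fun i => ?_
    fin_cases i
    · change degreeOf 0 g = 0
      omega
    · change degreeOf 1 g = 0
      omega
  refine ⟨fun hu => not_isUnit_zero (hvanish ▸ hu.map (aeval _)), fun f g hfg => ?_⟩
  rw [hfg, map_mul, mul_eq_zero] at hvanish
  exact hvanish.elim (fun h => .inr (hcofactor f g hfg h))
    fun h => .inl (hcofactor g f (hfg.trans (mul_comm f g)) h)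
end
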